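/- arXiv:1810.08128 — 3 statements merged into one kernel-verified Lean document; each statement's English description precedes it below -/
import Mathlib

section
/- Let b ∈ (1, 4) and a₀ = 0. Then there exist a positive integer k and numbers ε₀, ε₁, …, ε_{k−1} with ε_i ∈ (0, 1/(i+1)) for each i, such that the sequence defined by a_{i+1} = (1 + a_i)/(b − 1 − a_i) − ε_i satisfies a_i ∈ (0, b−1) for all 1 ≤ i ≤ k−1 and a_k > b−1. -/
/-- Lemma 6(i): for `b ∈ (1,4)` and `a₀ = 0` there are a positive integer `k` and
numbers `ε i ∈ (0, 1/(i+1))` such that the recursion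
`a (i+1) = (1 + a i)/(b - 1 - a i) - ε i` satisfies `a i ∈ (0, b-1)` for
`1 ≤ i ≤ k-1` and `a k > b - 1`. -/
theorem stmt_12 (b : ℝ) (hb1 : 1 < b) (hb4 : b < 4) :
    ∃ (k : ℕ) (ε a : ℕ → ℝ), 0 < k ∧ a 0 = 0 ∧
      (∀ i, i < k → ε i ∈ Set.Ioo 0 (1 / ((i : ℝ) + 1))) ∧
      (∀ i, i < k → a (i + 1) = (1 + a i) / (b - 1 - a i) - ε i) ∧
      (∀ i, 1 ≤ i → i < k → a i ∈ Set.Ioo 0 (b - 1)) ∧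
      b - 1 < a k := by
  obtain ⟨m, hm⟩ : ∃ m, m = 1 - (b - 2) ^ 2 / 4 := ⟨_, rfl⟩
  have hm0 : 0 < m := by rw [hm]; nlinarith
  have hc : 0 < b - 1 := by linarith
  obtain ⟨d, hd⟩ : ∃ d, d = m / (b - 1) / 2 := ⟨_, rfl⟩
  have hd0 : 0 < d := by rw [hd]; positivity
  have key : ∀ x, 0 ≤ x → x < b - 1 → x + 2 * d ≤ (1 + x) / (b - 1 - x) := by
    intro x hx0 hx
    have h1 : 0 < b - 1 - x := by linarith
    have h2 : 2 * d * (b - 1) = m := by rw [hd]; field_simp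
    rw [le_div_iff₀ h1]
    have h3 : 0 ≤ d * x := by positivity
    nlinarith [sq_nonneg (2 * x - (b - 2))]
  have step : ∀ (i : ℕ) (x : ℝ), ∃ e : ℝ, 0 < e ∧ e < 1 / ((i : ℝ) + 1) ∧ e ≤ d ∧
      (1 + x) / (b - 1 - x) - e ≠ b - 1 := by
    intro i x
    have hi : (0 : ℝ) < 1 / ((i : ℝ) + 1) := by positivity
    obtain ⟨t, ht0, ht⟩ := exists_between (lt_min hi hd0)
    have ht1 := lt_of_lt_of_le ht (min_le_left _ _)
    have ht2 := lt_of_lt_of_le ht (min_le_right _ _)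
    by_cases h : (1 + x) / (b - 1 - x) - t = b - 1
    · refine ⟨t / 2, by linarith, by linarith, by linarith, fun h' => by linarith⟩
    · exact ⟨t, ht0, ht1, ht2.le, h⟩
  choose e he0 he1 hed hne using step
  obtain ⟨a, ha0, ha⟩ : ∃ a : ℕ → ℝ, a 0 = 0 ∧
      ∀ i, a (i + 1) = (1 + a i) / (b - 1 - a i) - e i (a i) :=
    ⟨fun n => Nat.rec 0 (fun i x => (1 + x) / (b - 1 - x) - e i x) n, rfl, fun _ => rfl⟩
  have hnec : ∀ i, a i ≠ b - 1 := by
    intro i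
    cases i with
    | zero => rw [ha0]; exact hc.ne
    | succ n => rw [ha]; exact hne _ _
  have main : ∀ i : ℕ, (∀ j, j ≤ i → ¬ b - 1 < a j) → (i : ℝ) * d ≤ a i ∧ a i < b - 1 := by
    intro i
    induction i with
    | zero => intro _; rw [ha0]; simpa using hb1
    | succ n ih =>
      intro h
      obtain ⟨h1, h2⟩ := ih (fun j hj => h j (by omega))
      refine ⟨?_, lt_of_le_of_ne (not_lt.mp (h _ le_rfl)) (hnec _)⟩
      have h0 : 0 ≤ a n := le_trans (by positivity) h1
      have := key _ h0 h2
      have := hed n (a n)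
      rw [ha]
      push_cast
      linarith
  have hex : ∃ k, b - 1 < a k := by
    by_contra hcon
    push Not at hcon
    obtain ⟨n, hn⟩ := exists_nat_gt ((b - 1) / d)
    rw [div_lt_iff₀ hd0] at hn
    have := main n (fun j _ => not_lt.mpr (hcon j))
    linarith [this.1, this.2]
  classical
  refine ⟨Nat.find hex, fun i => e i (a i), a, ?_, ha0, fun i _ => ⟨he0 _ _, he1 _ _⟩,
    fun i _ => ha i, ?_, Nat.find_spec hex⟩
  · rw [Nat.find_pos, ha0]; linarith
  · intro i hi hik
    have h := main i (fun j hj => Nat.find_min hex (by omega))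
    have hi' : (0 : ℝ) < i := by exact_mod_cast hi
    exact ⟨lt_of_lt_of_le (by positivity) h.1, h.2⟩
end

section
/- Let b ≥ 4 and let x₁ = ((b−2) + √((b−2)² − 4))/2 be the maximal real solution of x² − (b−2)x + 1 = 0. If a₀ ∈ (x₁, b−1), then there exist a positive integer k and numbers ε₀, ε₁, …, ε_{k−1} with ε_i ∈ (0, 1/(i+1)) for each i, such that the sequence defined by a_{i+1} = (1 + a_i)/(b − 1 − a_i) − ε_i satisfies a_i ∈ (x₁, b−1) for all 1 ≤ i ≤ k−1 and a_k > b−1. -/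
theorem stmt_aux (f : ℝ → ℝ) (c hi δ : ℝ) (hδ : 0 < δ)
    (hf : ∀ x, c ≤ x → x < hi → x + δ ≤ f x) (n : ℕ) :
    ∀ (m : ℕ) (x : ℝ), c ≤ x → x < hi → hi - x ≤ n * (δ / 2) →
    ∃ (k : ℕ) (ε a : ℕ → ℝ), 0 < k ∧ a 0 = x ∧
      (∀ i, i < k → 0 < ε i ∧ ε i < 1 / (((i + m : ℕ) : ℝ) + 1)) ∧
      (∀ i, i < k → a (i + 1) = f (a i) - ε i) ∧
      (∀ i, i < k → c ≤ a i ∧ a i < hi) ∧ hi < a k := by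
  induction n with
  | zero => intro m x h1 h2 h3; simp at h3; linarith
  | succ n ih =>
    intro m x h1 h2 h3
    have hg := hf x h1 h2
    have hm : (0 : ℝ) < 1 / ((m : ℝ) + 1) := by positivity
    by_cases hc : hi < f x
    · have hp : 0 < min (1 / ((m : ℝ) + 1)) (f x - hi) := lt_min hm (by linarith)
      have hl := min_le_left (1 / ((m : ℝ) + 1)) (f x - hi)
      have hr := min_le_right (1 / ((m : ℝ) + 1)) (f x - hi)
      set e := min (1 / ((m : ℝ) + 1)) (f x - hi) with he
      refine ⟨1, fun _ => e / 2, fun i => if i = 0 then x else f x - e / 2,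
        one_pos, by simp, ?_, ?_, ?_, ?_⟩
      · intro i hi'
        obtain rfl : i = 0 := by omega
        simp only [Nat.zero_add]
        constructor <;> linarith
      · intro i hi'
        obtain rfl : i = 0 := by omega
        simp
      · intro i hi'
        obtain rfl : i = 0 := by omega
        simp [h1, h2]
      · simp; linarith
    · push Not at hc
      have hp : 0 < min (1 / ((m : ℝ) + 1)) δ := lt_min hm hδ
      have hl := min_le_left (1 / ((m : ℝ) + 1)) δ
      have hr := min_le_right (1 / ((m : ℝ) + 1)) δ
      set e := min (1 / ((m : ℝ) + 1)) δ with he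
      push_cast at h3
      obtain ⟨k, ε, a, hk, ha0, hε, hrec, hin, hend⟩ :=
        ih (m + 1) (f x - e / 2) (by linarith) (by linarith) (by linarith)
      refine ⟨k + 1, fun i => Nat.casesOn i (e / 2) ε, fun i => Nat.casesOn i x a,
        Nat.succ_pos _, rfl, ?_, ?_, ?_, hend⟩
      · intro i hi'
        cases i with
        | zero => 
          rw [Nat.zero_add]
          exact ⟨show 0 < e / 2 by linarith, show e / 2 < 1 / ((m : ℝ) + 1) by linarith⟩
        | succ i =>
          have := hε i (by omega)
          rw [show i + 1 + m = i + (m + 1) by omega]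
          exact this
      · intro i hi'
        cases i with
        | zero => exact ha0
        | succ i => exact hrec i (by omega)
      · intro i hi'
        cases i with
        | zero => exact ⟨h1, h2⟩
        | succ i => exact hin i (by omega)


/-- Lemma 6(ii): for `b ≥ 4`, with `x₁ = ((b-2) + √((b-2)² - 4))/2` the maximal root of
`x² - (b-2)x + 1 = 0`, and `a₀ ∈ (x₁, b-1)`, there are a positive integer `k` and
numbers `ε i ∈ (0, 1/(i+1))` such that the recursion
`a (i+1) = (1 + a i)/(b - 1 - a i) - ε i` satisfies `a i ∈ (x₁, b-1)` for
`1 ≤ i ≤ k-1` and `a k > b - 1`. -/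
theorem stmt_13 (b : ℝ) (hb : 4 ≤ b) (a₀ : ℝ)
    (ha₀ : a₀ ∈ Set.Ioo ((b - 2 + Real.sqrt ((b - 2) ^ 2 - 4)) / 2) (b - 1)) :
    ∃ (k : ℕ) (ε a : ℕ → ℝ), 0 < k ∧ a 0 = a₀ ∧
      (∀ i, i < k → ε i ∈ Set.Ioo 0 (1 / ((i : ℝ) + 1))) ∧
      (∀ i, i < k → a (i + 1) = (1 + a i) / (b - 1 - a i) - ε i) ∧
      (∀ i, 1 ≤ i → i < k →
        a i ∈ Set.Ioo ((b - 2 + Real.sqrt ((b - 2) ^ 2 - 4)) / 2) (b - 1)) ∧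
      b - 1 < a k := by

  obtain ⟨hlo, hhi⟩ := ha₀
  have hs0 := Real.sqrt_nonneg ((b - 2) ^ 2 - 4)
  have hs := Real.sq_sqrt (show 0 ≤ (b - 2) ^ 2 - 4 by nlinarith)
  set s := Real.sqrt ((b - 2) ^ 2 - 4) with hsdef
  have hq : 0 < a₀ ^ 2 - (b - 2) * a₀ + 1 := by
    have h1 : 0 < a₀ - (b - 2 + s) / 2 := by linarith
    have h2 : 0 < a₀ - (b - 2 - s) / 2 := by linarith
    nlinarith [mul_pos h1 h2]
  have hd : 0 < b - 1 - a₀ := by linarith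
  have hδ : 0 < (a₀ ^ 2 - (b - 2) * a₀ + 1) / (b - 1 - a₀) := div_pos hq hd
  set δ := (a₀ ^ 2 - (b - 2) * a₀ + 1) / (b - 1 - a₀) with hδdef
  have hf : ∀ x, a₀ ≤ x → x < b - 1 → x + δ ≤ (1 + x) / (b - 1 - x) := by
    intro x h1 h2
    have hdx : 0 < b - 1 - x := by linarith
    have hqx : a₀ ^ 2 - (b - 2) * a₀ + 1 ≤ x ^ 2 - (b - 2) * x + 1 := by
      nlinarith [mul_nonneg (sub_nonneg.2 h1) (show 0 ≤ x + a₀ - (b - 2) by linarith)]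
    have h3 : (1 + x) / (b - 1 - x) = x + (x ^ 2 - (b - 2) * x + 1) / (b - 1 - x) := by
      field_simp
      ring
    have h4 : δ ≤ (x ^ 2 - (b - 2) * x + 1) / (b - 1 - x) :=
      div_le_div₀ (by linarith) hqx hdx (by linarith)
    linarith
  obtain ⟨n, hn⟩ := exists_nat_ge ((b - 1 - a₀) / (δ / 2))
  rw [div_le_iff₀ (by linarith)] at hn
  obtain ⟨k, ε, a, hk, ha0, hε, hrec, hin, hend⟩ :=
    stmt_aux (fun x => (1 + x) / (b - 1 - x)) a₀ (b - 1) δ hδ hf n 0 a₀ le_rfl hhi hn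
  exact ⟨k, ε, a, hk, ha0, fun i h => hε i h, hrec,
    fun i _ h => ⟨lt_of_lt_of_le hlo (hin i h).1, (hin i h).2⟩, hend⟩
end

section
/- Let b ≥ 4, a₀ = 0, and let x₂ = ((b−2) − √((b−2)² − 4))/2 be the minimal real solution of x² − (b−2)x + 1 = 0. Then there exists a sequence (ε_i)_{i≥0} with ε_i ∈ (0, 1/(i+1)) for each i, such that the sequence defined by a_{i+1} = (1 + a_i)/(b − 1 − a_i) − ε_i satisfies a_i < a_{i+1} < x₂ for all i ≥ 0 and lim_{i→+∞} a_i = x₂. -/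
/-- Lemma 6(iii): for `b ≥ 4` and `a₀ = 0`, with `x₂ = ((b-2) - √((b-2)² - 4))/2` the
minimal root of `x² - (b-2)x + 1 = 0`, there is a sequence `ε i ∈ (0, 1/(i+1))` such
that the recursion `a (i+1) = (1 + a i)/(b - 1 - a i) - ε i` satisfies
`a i < a (i+1) < x₂` for all `i` and `a i → x₂`. -/
theorem stmt_14 (b : ℝ) (hb : 4 ≤ b) :
    ∃ (ε a : ℕ → ℝ), a 0 = 0 ∧
      (∀ i : ℕ, ε i ∈ Set.Ioo 0 (1 / ((i : ℝ) + 1))) ∧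
      (∀ i : ℕ, a (i + 1) = (1 + a i) / (b - 1 - a i) - ε i) ∧
      (∀ i : ℕ, a i < a (i + 1) ∧ a (i + 1) < (b - 2 - Real.sqrt ((b - 2) ^ 2 - 4)) / 2) ∧
      Filter.Tendsto a Filter.atTop
        (nhds ((b - 2 - Real.sqrt ((b - 2) ^ 2 - 4)) / 2)) := by
  have hq : ((b - 2 - Real.sqrt ((b - 2) ^ 2 - 4)) / 2) ^ 2
      - (b - 2) * ((b - 2 - Real.sqrt ((b - 2) ^ 2 - 4)) / 2) + 1 = 0 := by
    have := Real.sq_sqrt (show 0 ≤ (b - 2) ^ 2 - 4 by nlinarith)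
    linarith
  have hx0 : 0 < (b - 2 - Real.sqrt ((b - 2) ^ 2 - 4)) / 2 := by
    have : Real.sqrt ((b - 2) ^ 2 - 4) < b - 2 := by
      rw [Real.sqrt_lt' (by linarith)]
      linarith
    linarith
  have hxle : 2 * ((b - 2 - Real.sqrt ((b - 2) ^ 2 - 4)) / 2) ≤ b - 2 := by
    have := Real.sqrt_nonneg ((b - 2) ^ 2 - 4)
    linarith
  generalize (b - 2 - Real.sqrt ((b - 2) ^ 2 - 4)) / 2 = x at hq hx0 hxle ⊢
  let E : ℕ → ℝ → ℝ := fun i t =>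
    min (((1 + t) / (b - 1 - t) - t) / 2) (1 / (2 * ((i : ℝ) + 1)))
  let a : ℕ → ℝ := fun n => Nat.rec 0 (fun i t => (1 + t) / (b - 1 - t) - E i t) n
  have hrec : ∀ i, a (i + 1) = (1 + a i) / (b - 1 - a i) - E i (a i) := fun i => rfl
  have key : ∀ (i : ℕ) (t : ℝ), 0 ≤ t → t < x →
      0 < E i t ∧ E i t < 1 / ((i : ℝ) + 1) ∧
      t < (1 + t) / (b - 1 - t) - E i t ∧ (1 + t) / (b - 1 - t) - E i t < x ∧
      (x - t) ^ 2 ≤ 2 * (b - 1) * ((1 + t) / (b - 1 - t) - E i t - t) := by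
    intro i t h0 ht
    have hd : 0 < b - 1 - t := by linarith
    have hfx : (1 + t) / (b - 1 - t) < x := by
      rw [div_lt_iff₀ hd]; nlinarith
    have hi : (0 : ℝ) < (i : ℝ) + 1 := by positivity
    have hsq : (x - t) ^ 2 ≤ (b - 1) * ((1 + t) / (b - 1 - t) - t) := by
      have e : (1 + t) / (b - 1 - t) - t = ((x - t) * (b - 2 - x - t)) / (b - 1 - t) := by
        field_simp
        linarith
      have hp : (x - t) ^ 2 ≤ (x - t) * (b - 2 - x - t) := by nlinarith
      rw [e, ← mul_div_assoc, le_div_iff₀ hd]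
      nlinarith [sq_nonneg (x - t)]
    have hpos : 0 < (1 + t) / (b - 1 - t) - t := by
      have h1 : 0 < (x - t) ^ 2 := by
        have : 0 < x - t := by linarith
        positivity
      exact pos_of_mul_pos_right (lt_of_lt_of_le h1 hsq) (by linarith)
    have hE1 : E i t ≤ ((1 + t) / (b - 1 - t) - t) / 2 := min_le_left _ _
    have hE2 : E i t ≤ 1 / (2 * ((i : ℝ) + 1)) := min_le_right _ _
    have hE0 : 0 < E i t := lt_min (by linarith) (by positivity)
    refine ⟨hE0, lt_of_le_of_lt hE2 ?_, by linarith, by linarith, ?_⟩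
    · apply one_div_lt_one_div_of_lt hi; linarith
    · nlinarith
  have inv : ∀ i, 0 ≤ a i ∧ a i < x := by
    intro i
    induction i with
    | zero => exact ⟨le_refl _, hx0⟩
    | succ i ih =>
      obtain ⟨-, -, h3, h4, -⟩ := key i (a i) ih.1 ih.2
      rw [hrec]
      exact ⟨by linarith [ih.1], h4⟩
  have K := fun i => key i (a i) (inv i).1 (inv i).2
  refine ⟨fun i => E i (a i), a, rfl, fun i => ⟨(K i).1, (K i).2.1⟩, hrec,
    fun i => ⟨?_, (inv (i + 1)).2⟩, ?_⟩
  · rw [hrec]; exact (K i).2.2.1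
  have hmono : Monotone a := monotone_nat_of_le_succ fun i => by
    rw [hrec]; exact (K i).2.2.1.le
  have hbdd : BddAbove (Set.range a) := ⟨x, by rintro _ ⟨i, rfl⟩; exact (inv i).2.le⟩
  have hL := tendsto_atTop_ciSup hmono hbdd
  generalize (⨆ i, a i) = L at hL
  have hL1 := hL.comp (Filter.tendsto_add_atTop_nat 1)
  have hle : (x - L) ^ 2 ≤ 2 * (b - 1) * (L - L) := by
    refine le_of_tendsto_of_tendsto' ((hL.const_sub x).pow 2)
      ((hL1.sub hL).const_mul (2 * (b - 1))) fun i => ?_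
    have := (K i).2.2.2.2
    rw [← hrec] at this
    exact this
  have : x = L := by nlinarith
  rw [this]
  exact hL
end
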